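/- For a frame L the following are equivalent: (1) every element of L is a meet of covered primes of L (i.e. L is T_D-spatial); (2) the frame S_b(L)^op is spatial, i.e. every smooth sublocale of L is a meet in S_b(L)^op of primes of S_b(L)^op; (3) S_b(L), ordered by inclusion, is order-isomorphic to the powerset P(pt_D(L)) ordered by inclusion. -/

import Mathlib

open Set

universe u

namespace TD

variable {L : Type u} [Order.Frame L]

/-- A sublocale of a frame `L`: a subset closed under arbitrary meets and
under `a ⇨ -` for every `a : L`. -/
def IsSublocale (S : Set L) : Prop :=
  (∀ A : Set L, A ⊆ S → sInf A ∈ S) ∧ ∀ a : L, ∀ s ∈ S, (a ⇨ s) ∈ S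

/-- The covered primes of the (sub)frame `S` (meets computed in `L`,
which agree with meets in `S` when `S` is a sublocale).  The covered primes
of `L` itself are `ptD (Set.univ)`. -/
def ptD (S : Set L) : Set L :=
  {p | p ∈ S ∧ p ≠ ⊤ ∧ ∀ A : Set L, A ⊆ S → sInf A = p → p ∈ A}

/-- The primes of the (sub)frame `S`.  The primes of `L` itself are
`pt (Set.univ)`. -/
def pt (S : Set L) : Set L :=
  {p | p ∈ S ∧ p ≠ ⊤ ∧ ∀ x ∈ S, ∀ y ∈ S, p = x ⊓ y → p = x ∨ p = y}

/-- A D-sublocale: a sublocale all of whose covered primes are covered primes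
of the ambient frame `L`. -/
def IsDSublocale (S : Set L) : Prop :=
  IsSublocale S ∧ ptD S ⊆ ptD (univ : Set L)

/-- The join, computed in the coframe `S(L)` of all sublocales, of a family of
subsets of `L`: all meets of subsets of the union. -/
def sJoin (𝒮 : Set (Set L)) : Set L :=
  {x | ∃ A : Set L, A ⊆ ⋃₀ 𝒮 ∧ sInf A = x}

/-- Binary join in `S(L)`. -/
def join2 (S T : Set L) : Set L := sJoin {S, T}

/-- The closed sublocale `c(a) = ↑a`. -/
def closedSub (a : L) : Set L := Ici a

/-- The open sublocale `o(a) = {a ⇨ b | b ∈ L}`. -/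
def openSub (a : L) : Set L := {x | ∃ b : L, x = a ⇨ b}

/-- The Boolean sublocale `b(a) = {x ⇨ a | x ∈ L}`. -/
def bSub (a : L) : Set L := {x | ∃ y : L, x = y ⇨ a}

/-- A complemented sublocale: one having a complement in the coframe `S(L)`
(whose bottom is `{⊤}` and top is `L` itself, i.e. `Set.univ`). -/
def IsComplementedSublocale (C : Set L) : Prop :=
  IsSublocale C ∧ ∃ C' : Set L, IsSublocale C' ∧ C ∩ C' = {⊤} ∧ join2 C C' = univ

/-- A smooth sublocale: a join in `S(L)` of complemented sublocales. -/
def IsSmooth (S : Set L) : Prop :=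
  ∃ 𝒞 : Set (Set L), (∀ C ∈ 𝒞, IsComplementedSublocale C) ∧ S = sJoin 𝒞

/-- `M Y`: the closure of `Y` under arbitrary meets (with `⋀ ∅ = ⊤`). -/
def M (Y : Set L) : Set L := {x | ∃ A : Set L, A ⊆ Y ∧ sInf A = x}

/-- The (sub)frame `S` is `T_D`-spatial: every element of `S` is a meet of
covered primes of `S`. -/
def IsTDSpatialSub (S : Set L) : Prop :=
  ∀ s ∈ S, ∃ P : Set L, P ⊆ ptD S ∧ sInf P = s

/-- The (sub)frame `S` is spatial: every element of `S` is a meet of primes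
of `S`. -/
def IsSpatialSub (S : Set L) : Prop :=
  ∀ s ∈ S, ∃ P : Set L, P ⊆ pt S ∧ sInf P = s

/-- The primes of `L` lying above `a`, i.e. `pt(↑a)`. -/
def ptAbove (a : L) : Set L := {p | p ∈ pt (univ : Set L) ∧ a ≤ p}

/-- A prime of the frame `S_D(L)^op` (order-reversed coframe of D-sublocales):
a D-sublocale `P ≠ {⊤}` such that `P = S₁ ∨ S₂` (join in `S(L)`) with
`S₁, S₂` D-sublocales implies `P = S₁` or `P = S₂`. -/
def PrimeInSDop (P : Set L) : Prop :=
  IsDSublocale P ∧ P ≠ ({⊤} : Set L) ∧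
    ∀ S₁ S₂ : Set L, IsDSublocale S₁ → IsDSublocale S₂ →
      P = join2 S₁ S₂ → P = S₁ ∨ P = S₂

/-- A covered prime of the frame `S_D(L)^op`: a D-sublocale `P ≠ {⊤}` such
that whenever `P` is a join of a family of D-sublocales, it equals one of
them. -/
def CovPrimeInSDop (P : Set L) : Prop :=
  IsDSublocale P ∧ P ≠ ({⊤} : Set L) ∧
    ∀ 𝒮 : Set (Set L), (∀ T ∈ 𝒮, IsDSublocale T) → P = sJoin 𝒮 → ∃ T ∈ 𝒮, P = T

/-- A prime of the frame `S(L)^op`. -/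
def PrimeInSop (P : Set L) : Prop :=
  IsSublocale P ∧ P ≠ ({⊤} : Set L) ∧
    ∀ S₁ S₂ : Set L, IsSublocale S₁ → IsSublocale S₂ →
      P = join2 S₁ S₂ → P = S₁ ∨ P = S₂

/-- A prime of the frame `S_b(L)^op` of smooth sublocales. -/
def PrimeInSbop (P : Set L) : Prop :=
  IsSmooth P ∧ P ≠ ({⊤} : Set L) ∧
    ∀ S₁ S₂ : Set L, IsSmooth S₁ → IsSmooth S₂ →
      P = join2 S₁ S₂ → P = S₁ ∨ P = S₂

/-- A prime element of a complete lattice. -/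
def IsPrimeElt {α : Type*} [CompleteLattice α] (p : α) : Prop :=
  p ≠ ⊤ ∧ ∀ x y : α, p = x ⊓ y → p = x ∨ p = y

/-- A `T_D` topological space: `T₀` and every point has an open
neighbourhood `U` with `U \ {x}` open. -/
def IsTDSpace (X : Type*) [TopologicalSpace X] : Prop :=
  T0Space X ∧ ∀ x : X, ∃ U : Set X, IsOpen U ∧ x ∈ U ∧ IsOpen (U \ {x})

/-- A sober space: every prime of the frame of opens is of the form
`X ∖ cl {x}` for a unique point `x`. -/
def IsSoberSpace (X : Type*) [TopologicalSpace X] : Prop :=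
  ∀ p : TopologicalSpace.Opens X, IsPrimeElt p →
    ∃! x : X, p = ⟨(closure {x})ᶜ, isClosed_closure.isOpen_compl⟩

section Joins

theorem subset_M (Y : Set L) : Y ⊆ M Y := fun y hy =>
  ⟨{y}, singleton_subset_iff.2 hy, sInf_singleton⟩

theorem M_subset {Y S : Set L} (hS : ∀ A ⊆ S, sInf A ∈ S) (h : Y ⊆ S) : M Y ⊆ S := by
  rintro _ ⟨A, hA, rfl⟩
  exact hS A (hA.trans h)

theorem sInf_mem_M (Y : Set L) : ∀ A ⊆ M Y, sInf A ∈ M Y := by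
  intro A hA
  refine ⟨{y | y ∈ Y ∧ sInf A ≤ y}, fun y hy => hy.1, le_antisymm ?_ (le_sInf fun y hy => hy.2)⟩
  refine le_sInf fun a ha => ?_
  obtain ⟨B, hB, rfl⟩ := hA ha
  exact le_sInf fun b hb => sInf_le ⟨hB hb, (sInf_le ha).trans (sInf_le hb)⟩

theorem top_mem_of_sInf_mem {S : Set L} (hS : ∀ A ⊆ S, sInf A ∈ S) : ⊤ ∈ S := by
  simpa using hS ∅ (empty_subset S)

theorem inf_mem_of_sInf_mem {S : Set L} (hS : ∀ A ⊆ S, sInf A ∈ S) {x y : L}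
    (hx : x ∈ S) (hy : y ∈ S) : x ⊓ y ∈ S := by
  simpa using hS {x, y} (pair_subset hx hy)

theorem subset_sJoin {𝒮 : Set (Set L)} {S : Set L} (h : S ∈ 𝒮) : S ⊆ sJoin 𝒮 :=
  (subset_sUnion_of_mem h).trans (subset_M _)

theorem sJoin_subset {𝒮 : Set (Set L)} {T : Set L} (hT : ∀ A ⊆ T, sInf A ∈ T)
    (h : ∀ S ∈ 𝒮, S ⊆ T) : sJoin 𝒮 ⊆ T :=
  M_subset hT (sUnion_subset h)

theorem mem_join2 {S T : Set L} (hS : IsSublocale S) (hT : IsSublocale T) {x : L} :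
    x ∈ join2 S T ↔ ∃ s ∈ S, ∃ t ∈ T, x = s ⊓ t := by
  constructor
  · rintro ⟨A, hA, rfl⟩
    refine ⟨sInf (A ∩ S), hS.1 _ inter_subset_right, sInf (A ∩ T), hT.1 _ inter_subset_right, ?_⟩
    rw [← sInf_union, ← inter_union_distrib_left, inter_eq_left.2]
    simpa [sUnion_pair] using hA
  · rintro ⟨s, hs, t, ht, rfl⟩
    exact inf_mem_of_sInf_mem (sInf_mem_M _) (subset_sJoin (by simp) hs)
      (subset_sJoin (by simp) ht)

theorem IsSublocale.join2 {S T : Set L} (hS : IsSublocale S) (hT : IsSublocale T) :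
    IsSublocale (TD.join2 S T) := by
  refine ⟨sInf_mem_M _, fun a x hx => ?_⟩
  obtain ⟨s, hs, t, ht, rfl⟩ := (mem_join2 hS hT).1 hx
  exact (mem_join2 hS hT).2 ⟨_, hS.2 a s hs, _, hT.2 a t ht, himp_inf_distrib a s t⟩

theorem IsSublocale.inter {S T : Set L} (hS : IsSublocale S) (hT : IsSublocale T) :
    IsSublocale (S ∩ T) :=
  ⟨fun A hA => ⟨hS.1 A (hA.trans inter_subset_left), hT.1 A (hA.trans inter_subset_right)⟩,
    fun a s hs => ⟨hS.2 a s hs.1, hT.2 a s hs.2⟩⟩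

end Joins

section Complemented

theorem isSublocale_univ : IsSublocale (univ : Set L) :=
  ⟨fun _ _ => mem_univ _, fun _ _ _ => mem_univ _⟩

theorem isSublocale_singleton_top : IsSublocale ({⊤} : Set L) := by
  refine ⟨fun A hA => sInf_eq_top.2 fun a ha => hA ha, ?_⟩
  rintro a _ rfl
  exact himp_top

/-- Disjoint sublocales: if a meet `s ⊓ t` lies in the first one, then it equals `s`. -/
theorem left_le_right_of_inf_mem {S T : Set L} (hS : IsSublocale S) (hT : IsSublocale T)
    (hST : S ∩ T = {⊤}) {s t : L} (ht : t ∈ T) (h : s ⊓ t ∈ S) : s ≤ t := by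
  have h1 : s ⇨ t ∈ S ∩ T := by
    refine ⟨?_, hT.2 s t ht⟩
    simpa [himp_inf_distrib] using hS.2 s _ h
  rw [hST] at h1
  exact himp_eq_top_iff.1 h1

theorem IsComplementedSublocale.inter {C D : Set L} (hC : IsComplementedSublocale C)
    (hD : IsComplementedSublocale D) : IsComplementedSublocale (C ∩ D) := by
  obtain ⟨hC, C', hC', hCC', hCj⟩ := hC
  obtain ⟨hD, D', hD', hDD', hDj⟩ := hD
  refine ⟨hC.inter hD, join2 C' D', hC'.join2 hD', ?_, ?_⟩
  · refine subset_antisymm ?_ (singleton_subset_iff.2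
      (top_mem_of_sInf_mem ((hC.inter hD).inter (hC'.join2 hD')).1))
    rintro x ⟨⟨hxC, hxD⟩, hx⟩
    obtain ⟨y, hy, z, hz, rfl⟩ := (mem_join2 hC' hD').1 hx
    have hzy : z ≤ y :=
      left_le_right_of_inf_mem hC hC' hCC' hy (by rwa [inf_comm])
    rw [inf_eq_right.2 hzy] at hxD ⊢
    rw [← hDD']
    exact ⟨hxD, hz⟩
  · refine eq_univ_of_forall fun a => ?_
    obtain ⟨c, hc, c', hc', hac⟩ := (mem_join2 hC hC').1 (hCj ▸ mem_univ a)
    obtain ⟨d, hd, d', hd', had⟩ := (mem_join2 hD hD').1 (hDj ▸ mem_univ a)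
    have hat : a ≤ c' ⊓ d' := le_inf (hac ▸ inf_le_right) (had ▸ inf_le_right)
    have key : ∀ e, c' ⊓ d' ⊓ e = a → c' ⊓ d' ⇨ a = c' ⊓ d' ⇨ e := by
      rintro e rfl
      simp [himp_inf_distrib]
    have h1 : c' ⊓ d' ⊓ c = a := le_antisymm
      (hac.symm ▸ le_inf inf_le_right (inf_le_left.trans inf_le_left))
      (le_inf hat (hac ▸ inf_le_left))
    have h2 : c' ⊓ d' ⊓ d = a := le_antisymm
      (had.symm ▸ le_inf inf_le_right (inf_le_left.trans inf_le_right))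
      (le_inf hat (had ▸ inf_le_left))
    refine (mem_join2 (hC.inter hD) (hC'.join2 hD')).2 ⟨c' ⊓ d' ⇨ a, ⟨?_, ?_⟩, c' ⊓ d',
      (mem_join2 hC' hD').2 ⟨c', hc', d', hd', rfl⟩, ?_⟩
    · rw [key c h1]
      exact hC.2 _ _ hc
    · rw [key d h2]
      exact hD.2 _ _ hd
    · rw [himp_inf_self, inf_eq_left.2 hat]

theorem IsComplementedSublocale.of_compl {C C' : Set L} (hC : IsSublocale C)
    (hC' : IsSublocale C') (h : C ∩ C' = {⊤}) (hj : ∀ x, ∃ s ∈ C, ∃ t ∈ C', x = s ⊓ t) :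
    IsComplementedSublocale C :=
  ⟨hC, C', hC', h, eq_univ_of_forall fun x => (mem_join2 hC hC').2 (hj x)⟩

theorem mem_openSub {a x : L} : x ∈ openSub a ↔ a ⇨ x = x :=
  ⟨by rintro ⟨b, rfl⟩; exact himp_idem, fun h => ⟨x, h.symm⟩⟩

theorem isSublocale_closedSub (a : L) : IsSublocale (closedSub a) :=
  ⟨fun _ hA => le_sInf hA, fun _ _ hs => le_trans hs le_himp⟩

theorem isSublocale_openSub (a : L) : IsSublocale (openSub a) := by
  refine ⟨fun A hA => mem_openSub.2 (le_antisymm (le_sInf fun x hx => ?_) le_himp), ?_⟩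
  · rw [← mem_openSub.1 (hA hx)]
    exact himp_le_himp_left (sInf_le hx)
  · intro b s hs
    rw [mem_openSub, himp_left_comm, mem_openSub.1 hs]

theorem eq_himp_inf_himp_himp (a x : L) : x = (a ⇨ x) ⊓ ((a ⇨ x) ⇨ x) := by
  rw [inf_himp, inf_eq_right.2 le_himp]

theorem le_himp_himp_self (a x : L) : a ≤ (a ⇨ x) ⇨ x := by
  rw [le_himp_iff]
  exact inf_himp_le

theorem closedSub_inter_openSub (a : L) : closedSub a ∩ openSub a = {⊤} := by
  refine subset_antisymm ?_ (singleton_subset_iff.2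
    (top_mem_of_sInf_mem ((isSublocale_closedSub a).inter (isSublocale_openSub a)).1))
  rintro x ⟨h1, h2⟩
  rw [mem_openSub] at h2
  exact h2.symm.trans (himp_eq_top_iff.2 h1)

theorem isComplementedSublocale_closedSub (a : L) : IsComplementedSublocale (closedSub a) :=
  .of_compl (isSublocale_closedSub a) (isSublocale_openSub a) (closedSub_inter_openSub a)
    fun x => ⟨_, le_himp_himp_self a x, _, ⟨x, rfl⟩,
      (eq_himp_inf_himp_himp a x).trans (inf_comm _ _)⟩

theorem isComplementedSublocale_openSub (a : L) : IsComplementedSublocale (openSub a) :=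
  .of_compl (isSublocale_openSub a) (isSublocale_closedSub a)
    ((inter_comm _ _).trans (closedSub_inter_openSub a))
    fun x => ⟨_, ⟨x, rfl⟩, _, le_himp_himp_self a x, eq_himp_inf_himp_himp a x⟩

theorem isComplementedSublocale_univ : IsComplementedSublocale (univ : Set L) :=
  .of_compl isSublocale_univ isSublocale_singleton_top (univ_inter _)
    fun x => ⟨x, mem_univ x, ⊤, rfl, (inf_top_eq x).symm⟩

end Complemented

section CoveredPrimes

theorem inf_eq_of_mem_ptD {p x y : L} (hp : p ∈ ptD (univ : Set L)) (h : x ⊓ y = p) :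
    p = x ∨ p = y := by
  simpa using hp.2.2 {x, y} (subset_univ _) (by simpa using h)

theorem himp_of_mem_ptD {p : L} (hp : p ∈ ptD (univ : Set L)) (a : L) :
    a ⇨ p = p ∨ a ⇨ p = ⊤ := by
  rcases inf_eq_of_mem_ptD hp (eq_himp_inf_himp_himp a p).symm with h | h
  · exact .inl h.symm
  · refine .inr (himp_eq_top_iff.2 ?_)
    conv_rhs => rw [h]
    exact le_himp_himp_self a p

theorem isSublocale_pair {p : L} (hp : p ∈ ptD (univ : Set L)) :
    IsSublocale ({p, ⊤} : Set L) := by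
  constructor
  · intro A hA
    by_cases h : p ∈ A
    · refine .inl (le_antisymm (sInf_le h) (le_sInf fun a ha => ?_))
      rcases hA ha with rfl | rfl
      · exact le_rfl
      · exact le_top
    · refine .inr (sInf_eq_top.2 fun a ha => ?_)
      rcases hA ha with rfl | rfl
      · exact absurd ha h
      · rfl
  · rintro a _ (rfl | rfl)
    · exact himp_of_mem_ptD hp a
    · exact .inr himp_top

theorem isComplementedSublocale_pair {p : L} (hp : p ∈ ptD (univ : Set L)) :
    IsComplementedSublocale ({p, ⊤} : Set L) := by
  set q := sInf (Ioi p) with hq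
  have hpq : ¬ q ≤ p := fun h =>
    lt_irrefl p (hp.2.2 (Ioi p) (subset_univ _) (le_antisymm h (le_sInf fun x hx => le_of_lt hx)))
  refine .of_compl (C' := {x | (p ⇨ x) ⊓ q ≤ x}) (isSublocale_pair hp) ⟨?_, ?_⟩ ?_ ?_
  · exact fun A hA => le_sInf fun x hx =>
      (inf_le_inf_right q (himp_le_himp_left (sInf_le hx))).trans (hA hx)
  · intro a s hs
    rw [mem_ofPred_eq] at hs ⊢
    rw [himp_left_comm, le_himp_iff]
    refine le_trans (le_inf ?_ (inf_le_left.trans inf_le_right)) hs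
    exact (inf_le_inf_right a inf_le_left).trans himp_inf_le
  · ext x
    constructor
    · rintro ⟨rfl | rfl, hx⟩
      · exact absurd (by simpa using hx) hpq
      · rfl
    · rintro rfl
      exact ⟨.inr rfl, le_top⟩
  · intro x
    by_cases hx : x ≤ p
    · refine ⟨p, .inl rfl, (p ⇨ x) ⊓ (q ⊔ x), ?_, le_antisymm ?_ ?_⟩
      · refine inf_le_inf ?_ le_sup_left
        refine (himp_le_himp_left inf_le_left).trans ?_
        rw [himp_idem]
      · exact le_inf hx (le_inf le_himp le_sup_right)
      · exact (inf_le_inf_left p inf_le_left).trans inf_himp_le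
    · refine ⟨⊤, .inr rfl, x, ?_, (top_inf_eq x).symm⟩
      have hqx : q ≤ p ⊔ x := sInf_le (left_lt_sup.2 hx)
      refine (inf_le_inf_left _ hqx).trans ?_
      rw [inf_sup_left]
      exact sup_le himp_inf_le inf_le_right

theorem mem_ptD_of_isComplementedSublocale_pair {p : L} (hp : p ≠ ⊤)
    (h : IsComplementedSublocale ({p, ⊤} : Set L)) : p ∈ ptD (univ : Set L) := by
  obtain ⟨hC, C', hC', hd, hj⟩ := h
  refine ⟨mem_univ p, hp, fun A _ hA => ?_⟩
  by_contra hpA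
  have hAC : A ⊆ C' := by
    intro x hx
    obtain ⟨s, hs, t, ht, rfl⟩ := (mem_join2 hC hC').1 (hj ▸ mem_univ x)
    rcases hs with rfl | rfl
    · have : s ⊓ t = s := le_antisymm inf_le_left (hA.symm.le.trans (sInf_le hx))
      exact absurd (this ▸ hx) hpA
    · rwa [top_inf_eq]
  have : p ∈ ({p, ⊤} : Set L) ∩ C' := ⟨.inl rfl, hA ▸ hC'.1 A hAC⟩
  rw [hd] at this
  exact hp this

/-- A covered prime that is a meet of elements of `Y` lies in `Y`. -/
theorem mem_of_mem_ptD_of_mem_M {p : L} (hp : p ∈ ptD (univ : Set L)) {Y : Set L}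
    (h : p ∈ M Y) : p ∈ Y := by
  obtain ⟨A, hA, hAp⟩ := h
  exact hA (hp.2.2 A (subset_univ A) hAp)

end CoveredPrimes

section Smooth

theorem IsSmooth.sInf_mem {S : Set L} (hS : IsSmooth S) : ∀ A ⊆ S, sInf A ∈ S := by
  obtain ⟨𝒞, -, rfl⟩ := hS
  exact sInf_mem_M _

theorem himp_sInf_image (a : L) (A : Set L) : a ⇨ sInf A = sInf ((a ⇨ ·) '' A) :=
  eq_of_forall_le_iff fun c => by simp [le_himp_iff]

theorem IsSmooth.himp_mem {S : Set L} (hS : IsSmooth S) (a : L) {s : L} (hs : s ∈ S) :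
    a ⇨ s ∈ S := by
  obtain ⟨𝒞, h𝒞, rfl⟩ := hS
  obtain ⟨A, hA, rfl⟩ := hs
  rw [himp_sInf_image]
  refine ⟨_, ?_, rfl⟩
  rintro _ ⟨x, hx, rfl⟩
  obtain ⟨C, hC, hxC⟩ := hA hx
  exact ⟨C, hC, (h𝒞 C hC).1.2 a x hxC⟩

theorem IsSmooth.isSublocale {S : Set L} (hS : IsSmooth S) : IsSublocale S :=
  ⟨hS.sInf_mem, fun a _ hs => hS.himp_mem a hs⟩

theorem IsComplementedSublocale.isSmooth {C : Set L} (hC : IsComplementedSublocale C) :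
    IsSmooth C :=
  ⟨{C}, by simpa using hC, subset_antisymm (subset_sJoin rfl)
    (sJoin_subset hC.1.1 (by simp))⟩

theorem isSmooth_sJoin {𝒮 : Set (Set L)} (h : ∀ S ∈ 𝒮, IsSmooth S) : IsSmooth (sJoin 𝒮) := by
  refine ⟨{C | IsComplementedSublocale C ∧ ∃ S ∈ 𝒮, C ⊆ S}, fun C hC => hC.1,
    subset_antisymm (sJoin_subset (sInf_mem_M _) fun S hS => ?_)
      (sJoin_subset (sInf_mem_M _) ?_)⟩
  · obtain ⟨𝒞, h𝒞, rfl⟩ := h S hS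
    exact sJoin_subset (sInf_mem_M _) fun C hC =>
      subset_sJoin ⟨h𝒞 C hC, _, hS, subset_sJoin hC⟩
  · rintro C ⟨-, S, hS, hCS⟩
    exact hCS.trans (subset_sJoin hS)

theorem IsSmooth.inter_closedSub {S : Set L} (hS : IsSmooth S) (a : L) :
    IsSmooth (S ∩ closedSub a) := by
  obtain ⟨𝒞, h𝒞, rfl⟩ := hS
  refine ⟨(· ∩ closedSub a) '' 𝒞, ?_, subset_antisymm ?_ (sJoin_subset ?_ ?_)⟩
  · rintro _ ⟨C, hC, rfl⟩
    exact (h𝒞 C hC).inter (isComplementedSublocale_closedSub a)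
  · rintro _ ⟨⟨A, hA, rfl⟩, ha⟩
    refine ⟨A, fun x hx => ?_, rfl⟩
    obtain ⟨C, hC, hxC⟩ := hA hx
    exact ⟨_, ⟨C, hC, rfl⟩, hxC, le_trans ha (sInf_le hx)⟩
  · exact fun A hA => ⟨sInf_mem_M _ A (hA.trans inter_subset_left),
      (isSublocale_closedSub a).1 A (hA.trans inter_subset_right)⟩
  · rintro _ ⟨C, hC, rfl⟩
    exact inter_subset_inter_left _ (subset_sJoin hC)

theorem IsSmooth.inter_openSub {S : Set L} (hS : IsSmooth S) (a : L) :
    IsSmooth (S ∩ openSub a) := by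
  obtain ⟨𝒞, h𝒞, rfl⟩ := hS
  refine ⟨(· ∩ openSub a) '' 𝒞, ?_, subset_antisymm ?_ (sJoin_subset ?_ ?_)⟩
  · rintro _ ⟨C, hC, rfl⟩
    exact (h𝒞 C hC).inter (isComplementedSublocale_openSub a)
  · rintro _ ⟨⟨A, hA, rfl⟩, ha⟩
    rw [mem_openSub, himp_sInf_image] at ha
    refine ⟨_, ?_, ha⟩
    rintro _ ⟨x, hx, rfl⟩
    obtain ⟨C, hC, hxC⟩ := hA hx
    exact ⟨_, ⟨C, hC, rfl⟩, (h𝒞 C hC).1.2 a x hxC, x, rfl⟩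
  · exact fun A hA => ⟨sInf_mem_M _ A (hA.trans inter_subset_left),
      (isSublocale_openSub a).1 A (hA.trans inter_subset_right)⟩
  · rintro _ ⟨C, hC, rfl⟩
    exact inter_subset_inter_left _ (subset_sJoin hC)

theorem IsSmooth.eq_join2_closedSub_openSub {S : Set L} (hS : IsSmooth S) (a : L) :
    S = join2 (S ∩ closedSub a) (S ∩ openSub a) := by
  refine subset_antisymm (fun x hx => ?_) (sJoin_subset hS.sInf_mem (by simp))
  refine (mem_join2 (hS.inter_closedSub a).isSublocale (hS.inter_openSub a).isSublocale).2
    ⟨(a ⇨ x) ⇨ x, ⟨hS.himp_mem _ hx, le_himp_himp_self a x⟩, a ⇨ x, ⟨hS.himp_mem a hx, x, rfl⟩, ?_⟩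
  rw [inf_comm]
  exact eq_himp_inf_himp_himp a x

/-- The primes of `S_b(L)^op` are the two-element sublocales given by covered primes. -/
theorem PrimeInSbop.exists_eq_pair {P : Set L} (hP : PrimeInSbop P) :
    ∃ p ∈ ptD (univ : Set L), P = {p, ⊤} := by
  obtain ⟨hS, hne, hirr⟩ := hP
  have hdich : ∀ a, P ⊆ closedSub a ∨ P ⊆ openSub a := fun a =>
    (hirr _ _ (hS.inter_closedSub a) (hS.inter_openSub a)
      (hS.eq_join2_closedSub_openSub a)).imp (fun h => inter_eq_left.1 h.symm)
      (fun h => inter_eq_left.1 h.symm)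
  have hp : sInf P ∈ P := hS.sInf_mem P subset_rfl
  have htop : ⊤ ∈ P := top_mem_of_sInf_mem hS.sInf_mem
  have hpair : P = {sInf P, ⊤} := by
    refine subset_antisymm (fun x hx => ?_) (pair_subset hp htop)
    rcases hdich x with h | h
    · exact .inl (le_antisymm (h hp) (sInf_le hx))
    · refine .inr ?_
      have := mem_openSub.1 (h hx)
      rwa [himp_self, eq_comm] at this
  have hptop : sInf P ≠ ⊤ := fun h => hne (by rw [hpair, h, pair_eq_singleton])
  refine ⟨sInf P, mem_ptD_of_isComplementedSublocale_pair hptop ?_, hpair⟩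
  rw [← hpair]
  obtain ⟨𝒞, h𝒞, hP𝒞⟩ := hS
  obtain ⟨C, hC, hne⟩ : ∃ C ∈ 𝒞, ¬ C ⊆ {⊤} := by
    by_contra! h
    refine hne (subset_antisymm ?_ (singleton_subset_iff.2 htop))
    rw [hP𝒞]
    exact sJoin_subset isSublocale_singleton_top.1 h
  have hCP : C ⊆ P := hP𝒞 ▸ subset_sJoin hC
  have hpC : sInf P ∈ C := by
    obtain ⟨x, hx, hxt⟩ := not_subset.1 hne
    have h := hCP hx
    rw [hpair] at h
    rcases h with h | h
    · exact h ▸ hx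
    · exact absurd h hxt
  have : C = P := by
    refine hCP.antisymm ?_
    rw [hpair]
    exact pair_subset hpC (top_mem_of_sInf_mem (h𝒞 C hC).1.1)
  exact this ▸ h𝒞 C hC

theorem isSmooth_M {Y : Set L} (hY : Y ⊆ ptD (univ : Set L)) : IsSmooth (M Y) := by
  have h : M Y = sJoin ((fun p => ({p, ⊤} : Set L)) '' Y) := by
    refine subset_antisymm (M_subset (sInf_mem_M _) fun p hp =>
      subset_sJoin (mem_image_of_mem _ hp) (.inl rfl)) (sJoin_subset (sInf_mem_M _) ?_)
    rintro _ ⟨p, hp, rfl⟩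
    exact pair_subset (subset_M Y hp) (top_mem_of_sInf_mem (sInf_mem_M Y))
  rw [h]
  refine isSmooth_sJoin ?_
  rintro _ ⟨p, hp, rfl⟩
  exact (isComplementedSublocale_pair (hY hp)).isSmooth

theorem IsComplementedSublocale.subset_M_inter_ptD
    (hL : ∀ a : L, ∃ P : Set L, P ⊆ ptD (univ : Set L) ∧ sInf P = a)
    {C : Set L} (hC : IsComplementedSublocale C) : C ⊆ M (C ∩ ptD (univ : Set L)) := by
  obtain ⟨hC, C', hC', hd, hj⟩ := hC
  intro c hc
  obtain ⟨P, hP, rfl⟩ := hL c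
  have hPu : P = P ∩ C ∪ P ∩ C' := by
    rw [← inter_union_distrib_left, eq_comm, inter_eq_left]
    intro p hp
    have := mem_of_mem_ptD_of_mem_M (hP hp) (Y := ⋃₀ {C, C'})
      (hj.symm.subset (mem_univ p))
    rwa [sUnion_pair] at this
  refine ⟨P ∩ C, fun p hp => ⟨hp.2, hP hp.1⟩, ?_⟩
  have hle : sInf (P ∩ C) ≤ sInf (P ∩ C') :=
    left_le_right_of_inf_mem hC hC' hd (hC'.1 _ inter_subset_right)
      (by rwa [← sInf_union, ← hPu])
  conv_rhs => rw [hPu, sInf_union, inf_eq_left.2 hle]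

theorem IsSmooth.eq_M_inter_ptD
    (hL : ∀ a : L, ∃ P : Set L, P ⊆ ptD (univ : Set L) ∧ sInf P = a)
    {S : Set L} (hS : IsSmooth S) : S = M (S ∩ ptD (univ : Set L)) := by
  refine subset_antisymm ?_ (M_subset hS.sInf_mem inter_subset_left)
  obtain ⟨𝒞, h𝒞, rfl⟩ := hS
  exact sJoin_subset (sInf_mem_M _) fun C hC =>
    ((h𝒞 C hC).subset_M_inter_ptD hL).trans (M_subset (sInf_mem_M _)
      ((inter_subset_inter_left _ (subset_sJoin hC)).trans (subset_M _)))

/-- Over a `T_D`-spatial frame, smooth sublocales correspond to sets of covered primes. -/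
def smoothOrderIso (hL : ∀ a : L, ∃ P : Set L, P ⊆ ptD (univ : Set L) ∧ sInf P = a) :
    {S : Set L // IsSmooth S} ≃o Set (ptD (univ : Set L)) where
  toFun S := {p | (p : L) ∈ S.1}
  invFun Y := ⟨M (Subtype.val '' Y), isSmooth_M (by rintro _ ⟨p, -, rfl⟩; exact p.2)⟩
  left_inv S := Subtype.ext (by
    conv_rhs => rw [S.2.eq_M_inter_ptD hL]
    exact congrArg M (Subtype.image_preimage_coe _ _ |>.trans (inter_comm _ _)))
  right_inv Y := by
    ext p
    refine ⟨fun h => ?_, fun h => subset_M _ ⟨p, h, rfl⟩⟩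
    simpa using mem_of_mem_ptD_of_mem_M p.2 h
  map_rel_iff' {S T} := by
    refine ⟨fun h => ?_, fun h p hp => h hp⟩
    change S.1 ⊆ T.1
    rw [S.2.eq_M_inter_ptD hL]
    exact M_subset T.2.sInf_mem fun x hx => h (a := ⟨x, hx.2⟩) hx.1

theorem primeInSbop_symm_singleton {X : Type*} (f : {S : Set L // IsSmooth S} ≃o Set X) (p : X) :
    PrimeInSbop (f.symm {p}).1 := by
  refine ⟨(f.symm {p}).2, fun h => ?_, fun S₁ S₂ h₁ h₂ h => ?_⟩
  · have hle : f.symm {p} ≤ f.symm ∅ := by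
      change (f.symm {p}).1 ⊆ (f.symm ∅).1
      rw [h, singleton_subset_iff]
      exact top_mem_of_sInf_mem (f.symm ∅).2.sInf_mem
    exact (f.symm.le_iff_le.1 hle) rfl
  · have hS₁ : S₁ ⊆ (f.symm {p}).1 := h ▸ subset_sJoin (by simp)
    have hS₂ : S₂ ⊆ (f.symm {p}).1 := h ▸ subset_sJoin (by simp)
    have hle : f ⟨S₁, h₁⟩ ⊆ {p} := f.le_symm_apply.1 hS₁
    rcases subset_singleton_iff_eq.1 hle with h0 | h1
    · right
      have h12 : (⟨S₁, h₁⟩ : {S : Set L // IsSmooth S}) ≤ ⟨S₂, h₂⟩ := by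
        rw [← f.le_iff_le, h0]
        exact empty_subset _
      refine subset_antisymm ?_ hS₂
      rw [h]
      refine sJoin_subset h₂.sInf_mem ?_
      rintro _ (rfl | rfl)
      · exact h12
      · exact subset_rfl
    · left
      rw [← h1, f.symm_apply_apply]

end Smooth

/-- TFAE: (1) `L` is `T_D`-spatial; (2) the frame `S_b(L)^op`
is spatial (every smooth sublocale is a join in `S(L)` of primes of
`S_b(L)^op`); (3) `S_b(L)` is order-isomorphic to `P(pt_D(L))`. -/
theorem Sb_spatial_tfae (L : Type u) [Order.Frame L] :
    [∀ a : L, ∃ P : Set L, P ⊆ ptD (univ : Set L) ∧ sInf P = a,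
     ∀ S : Set L, IsSmooth S →
       ∃ 𝒮 : Set (Set L), (∀ P ∈ 𝒮, PrimeInSbop P) ∧ S = sJoin 𝒮,
     Nonempty ({S : Set L // IsSmooth S} ≃o Set (ptD (univ : Set L)))].TFAE := by
  tfae_have 1 → 3 := fun h => ⟨smoothOrderIso h⟩
  tfae_have 3 → 2 := by
    rintro ⟨f⟩ S hS
    have hprime : ∀ P ∈ (fun p => (f.symm {p}).1) '' f ⟨S, hS⟩, PrimeInSbop P := by
      rintro _ ⟨p, -, rfl⟩
      exact primeInSbop_symm_singleton f p
    refine ⟨_, hprime, subset_antisymm ?_ (sJoin_subset hS.sInf_mem ?_)⟩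
    · have hJ := isSmooth_sJoin fun P hP => (hprime P hP).1
      have hle : (⟨S, hS⟩ : {S : Set L // IsSmooth S}) ≤ ⟨_, hJ⟩ := by
        rw [← f.le_iff_le]
        intro p hp
        have hpJ : f.symm {p} ≤ ⟨_, hJ⟩ := subset_sJoin (mem_image_of_mem _ hp)
        exact f.symm_apply_le.1 hpJ rfl
      exact hle
    · rintro _ ⟨p, hp, rfl⟩
      have hle : f.symm {p} ≤ ⟨S, hS⟩ := f.symm_apply_le.2 (singleton_subset_iff.2 hp)
      exact hle
  tfae_have 2 → 1 := by
    intro h a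
    obtain ⟨𝒮, h𝒮, hu⟩ := h univ isComplementedSublocale_univ.isSmooth
    obtain ⟨A, hA, rfl⟩ : a ∈ sJoin 𝒮 := hu ▸ mem_univ a
    refine ⟨A \ {⊤}, ?_, sInf_sdiff_singleton_top A⟩
    rintro x ⟨hx, hxt⟩
    obtain ⟨P, hP, hxP⟩ := hA hx
    obtain ⟨p, hp, rfl⟩ := (h𝒮 P hP).exists_eq_pair
    rcases hxP with rfl | hx'
    · exact hp
    · exact absurd hx' hxt
  tfae_finish

end TD
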